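/- arXiv:1707.04667 — 2 statements merged into one kernel-verified Lean document; each statement's English description precedes it below -/
import Mathlib

section
/- The operators r_i on P⁻ satisfy: r_i² = 0 for 1 ≤ i ≤ n−1; r_i r_j + r_j r_i = 0 whenever |i − j| ≥ 2; and the braid relation r_i r_{i+1} r_i = r_{i+1} r_i r_{i+1} for 1 ≤ i ≤ n−2. -/
noncomputable section

/-- The defining relations of the skew polynomial ring
`P⁻ = ℂ⟨x₁,…,xₙ⟩/⟨xᵢxⱼ + xⱼxᵢ : i ≠ j⟩`. -/
inductive SkewRel (n : ℕ) : FreeAlgebra ℂ (Fin n) → FreeAlgebra ℂ (Fin n) → Prop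
  | anticomm (i j : Fin n) (h : i ≠ j) :
      SkewRel n (FreeAlgebra.ι ℂ i * FreeAlgebra.ι ℂ j)
        (-(FreeAlgebra.ι ℂ j * FreeAlgebra.ι ℂ i))

/-- The skew polynomial ring `P⁻`. -/
abbrev SkewPoly (n : ℕ) := RingQuot (SkewRel n)

/-- The generators `xᵢ` of `P⁻`. -/
def X {n : ℕ} (i : Fin n) : SkewPoly n :=
  RingQuot.mkAlgHom ℂ (SkewRel n) (FreeAlgebra.ι ℂ i)

/-- `f ∈ P⁻` is homogeneous of degree `d`: it lies in the span of the degree-`d` monomials. -/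
def IsHomog {n : ℕ} (d : ℕ) (f : SkewPoly n) : Prop :=
  f ∈ Submodule.span ℂ
    {m : SkewPoly n | ∃ w : List (Fin n), w.length = d ∧ m = (w.map X).prod}

/-- The operator of left multiplication by `xᵢ` on `P⁻`. -/
def mulX {n : ℕ} (i : Fin n) : Module.End ℂ (SkewPoly n) :=
  LinearMap.mulLeft ℂ (X i)

section SkewPolyOperators

variable {n : ℕ}

/-- Two linear maps on `P⁻` agree if they agree at `1` and agreement propagates along left
multiplication by generators. -/
theorem SkewPoly.linearMap_ext {A B : Module.End ℂ (SkewPoly n)} (h1 : A 1 = B 1)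
    (hX : ∀ (j : Fin n) (f : SkewPoly n), A f = B f → A (X j * f) = B (X j * f)) : A = B := by
  have key : ∀ (a : FreeAlgebra ℂ (Fin n)) (f : SkewPoly n), A f = B f →
      A (RingQuot.mkAlgHom ℂ (SkewRel n) a * f) = B (RingQuot.mkAlgHom ℂ (SkewRel n) a * f) := by
    intro a
    induction a using FreeAlgebra.induction with
    | grade0 c =>
      intro f hf
      rw [AlgHom.commutes, ← Algebra.smul_def, map_smul, map_smul, hf]
    | grade1 j => exact fun f hf => hX j f hf
    | mul a b ha hb =>
      intro f hf
      rw [map_mul (RingQuot.mkAlgHom ℂ (SkewRel n)), mul_assoc]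
      exact ha _ (hb _ hf)
    | add a b ha hb =>
      intro f hf
      rw [map_add, add_mul, map_add, map_add, ha _ hf, hb _ hf]
  ext f
  obtain ⟨a, rfl⟩ := RingQuot.mkAlgHom_surjective ℂ (SkewRel n) f
  simpa using key a 1 h1

theorem isHomog_one : IsHomog 0 (1 : SkewPoly n) :=
  Submodule.subset_span ⟨[], rfl, rfl⟩

theorem isHomog_X (i : Fin n) : IsHomog 1 (X i) :=
  Submodule.subset_span ⟨[i], rfl, by simp⟩

variable {s : Fin n → Fin n → (SkewPoly n →ₐ[ℂ] SkewPoly n)}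
  {r : Fin n → Fin n → Module.End ℂ (SkewPoly n)}

theorem swapHom_mul_apply
    (hs : ∀ i k j : Fin n, i ≠ k → s i k (X j) = X (Equiv.swap i k j))
    {a b c d : Fin n} (hab : a ≠ b) (hcd : c ≠ d) (f : SkewPoly n) :
    s a b (s c d f) = s c d (s (Equiv.swap c d a) (Equiv.swap c d b) f) := by
  have hab' : Equiv.swap c d a ≠ Equiv.swap c d b := (Equiv.swap c d).injective.ne hab
  have h : (s a b).toLinearMap ∘ₗ (s c d).toLinearMap =
      (s c d).toLinearMap ∘ₗ (s (Equiv.swap c d a) (Equiv.swap c d b)).toLinearMap := by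
    refine SkewPoly.linearMap_ext (by simp) fun j f hf => ?_
    simp only [LinearMap.comp_apply, AlgHom.toLinearMap_apply] at hf ⊢
    simp only [map_mul, hs _ _ _ hab, hs _ _ _ hcd, hs _ _ _ hab', hf]
    rw [Equiv.swap_apply_apply]
    simp
  exact LinearMap.congr_fun h f

theorem swapHom_comm
    (hs : ∀ i k j : Fin n, i ≠ k → s i k (X j) = X (Equiv.swap i k j))
    {a b : Fin n} (hab : a ≠ b) (f : SkewPoly n) : s a b f = s b a f := by
  have h : (s a b).toLinearMap = (s b a).toLinearMap := by
    refine SkewPoly.linearMap_ext (by simp) fun j f hf => ?_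
    simp only [AlgHom.toLinearMap_apply] at hf ⊢
    rw [map_mul, map_mul, hs _ _ _ hab, hs _ _ _ hab.symm, hf, Equiv.swap_comm]
  exact LinearMap.congr_fun h f

theorem oddOp_comm
    (hs : ∀ i k j : Fin n, i ≠ k → s i k (X j) = X (Equiv.swap i k j))
    (hr1 : ∀ i k : Fin n, i ≠ k → r i k 1 = 0)
    (hrX : ∀ i k : Fin n, i ≠ k → ∀ (j : Fin n) (f : SkewPoly n),
      r i k (X j * f) = (if j = i ∨ j = k then s i k f else 0) - X j * r i k f)
    {a b : Fin n} (hab : a ≠ b) : r a b = r b a := by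
  refine SkewPoly.linearMap_ext (by rw [hr1 _ _ hab, hr1 _ _ hab.symm]) fun j f hf => ?_
  rw [hrX _ _ hab, hrX _ _ hab.symm, hf, swapHom_comm hs hab]
  simp only [or_comm]

theorem oddOp_swapHom_apply
    (hs : ∀ i k j : Fin n, i ≠ k → s i k (X j) = X (Equiv.swap i k j))
    (hr1 : ∀ i k : Fin n, i ≠ k → r i k 1 = 0)
    (hrX : ∀ i k : Fin n, i ≠ k → ∀ (j : Fin n) (f : SkewPoly n),
      r i k (X j * f) = (if j = i ∨ j = k then s i k f else 0) - X j * r i k f)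
    {a b c d : Fin n} (hab : a ≠ b) (hcd : c ≠ d) (f : SkewPoly n) :
    r a b (s c d f) = s c d (r (Equiv.swap c d a) (Equiv.swap c d b) f) := by
  have hab' : Equiv.swap c d a ≠ Equiv.swap c d b := (Equiv.swap c d).injective.ne hab
  have h : r a b ∘ₗ (s c d).toLinearMap =
      (s c d).toLinearMap ∘ₗ r (Equiv.swap c d a) (Equiv.swap c d b) := by
    refine SkewPoly.linearMap_ext (by simp [hr1 _ _ hab, hr1 _ _ hab']) fun j f hf => ?_
    simp only [LinearMap.comp_apply, AlgHom.toLinearMap_apply] at hf ⊢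
    have hj : ∀ e, Equiv.swap c d j = e ↔ j = Equiv.swap c d e := fun e =>
      Equiv.swap_apply_eq_iff
    rw [map_mul, hs _ _ _ hcd, hrX _ _ hab, hrX _ _ hab', map_sub, map_mul, hs _ _ _ hcd, hf,
      swapHom_mul_apply hs hab hcd]
    simp only [hj]
    split_ifs <;> simp
  exact LinearMap.congr_fun h f

theorem oddOp_sq
    (hs : ∀ i k j : Fin n, i ≠ k → s i k (X j) = X (Equiv.swap i k j))
    (hr1 : ∀ i k : Fin n, i ≠ k → r i k 1 = 0)
    (hrX : ∀ i k : Fin n, i ≠ k → ∀ (j : Fin n) (f : SkewPoly n),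
      r i k (X j * f) = (if j = i ∨ j = k then s i k f else 0) - X j * r i k f)
    {a b : Fin n} (hab : a ≠ b) : r a b * r a b = 0 := by
  refine SkewPoly.linearMap_ext (by simp [hr1 _ _ hab]) fun j f hf => ?_
  simp only [Module.End.mul_apply, LinearMap.zero_apply] at hf ⊢
  have h := oddOp_swapHom_apply hs hr1 hrX hab hab f
  rw [Equiv.swap_apply_left, Equiv.swap_apply_right,
    oddOp_comm hs hr1 hrX hab.symm] at h
  rw [hrX _ _ hab, map_sub, hrX _ _ hab, hf]
  split_ifs <;> simp [h]

theorem oddOp_anticomm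
    (hs : ∀ i k j : Fin n, i ≠ k → s i k (X j) = X (Equiv.swap i k j))
    (hr1 : ∀ i k : Fin n, i ≠ k → r i k 1 = 0)
    (hrX : ∀ i k : Fin n, i ≠ k → ∀ (j : Fin n) (f : SkewPoly n),
      r i k (X j * f) = (if j = i ∨ j = k then s i k f else 0) - X j * r i k f)
    {a b c d : Fin n} (hab : a ≠ b) (hcd : c ≠ d) (hac : a ≠ c) (had : a ≠ d) (hbc : b ≠ c)
    (hbd : b ≠ d) : r a b * r c d + r c d * r a b = 0 := by
  refine SkewPoly.linearMap_ext (by simp [hr1 _ _ hab, hr1 _ _ hcd]) fun j f hf => ?_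
  simp only [Module.End.mul_apply, LinearMap.add_apply, LinearMap.zero_apply] at hf ⊢
  have h₁ := oddOp_swapHom_apply hs hr1 hrX hab hcd f
  have h₂ := oddOp_swapHom_apply hs hr1 hrX hcd hab f
  rw [Equiv.swap_apply_of_ne_of_ne hac had, Equiv.swap_apply_of_ne_of_ne hbc hbd] at h₁
  rw [Equiv.swap_apply_of_ne_of_ne hac.symm hbc.symm,
    Equiv.swap_apply_of_ne_of_ne had.symm hbd.symm] at h₂
  have hf' : X j * r a b (r c d f) + X j * r c d (r a b f) = 0 := by rw [← mul_add, hf, mul_zero]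
  rw [hrX _ _ hab, hrX _ _ hcd, map_sub, map_sub, hrX _ _ hab, hrX _ _ hcd]
  refine Eq.trans ?_ hf'
  split_ifs <;> simp only [h₁, h₂, map_zero] <;> abel

theorem oddOp_three_term
    (hs : ∀ i k j : Fin n, i ≠ k → s i k (X j) = X (Equiv.swap i k j))
    (hr1 : ∀ i k : Fin n, i ≠ k → r i k 1 = 0)
    (hrX : ∀ i k : Fin n, i ≠ k → ∀ (j : Fin n) (f : SkewPoly n),
      r i k (X j * f) = (if j = i ∨ j = k then s i k f else 0) - X j * r i k f)
    {a b c : Fin n} (hab : a ≠ b) (hbc : b ≠ c) (hac : a ≠ c) :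
    r a b * r a c + r b c * r a b + r a c * r b c = 0 := by
  refine SkewPoly.linearMap_ext (by simp [hr1 _ _ hab, hr1 _ _ hac, hr1 _ _ hbc])
    fun j f hf => ?_
  simp only [Module.End.mul_apply, LinearMap.add_apply, LinearMap.zero_apply] at hf ⊢
  have h₁ := oddOp_swapHom_apply hs hr1 hrX hab hac f
  have h₂ := oddOp_swapHom_apply hs hr1 hrX hbc hab f
  have h₃ := oddOp_swapHom_apply hs hr1 hrX hac hbc f
  rw [Equiv.swap_apply_left, Equiv.swap_apply_of_ne_of_ne hab.symm hbc,
    oddOp_comm hs hr1 hrX hbc.symm] at h₁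
  rw [Equiv.swap_apply_right, Equiv.swap_apply_of_ne_of_ne hac.symm hbc.symm] at h₂
  rw [Equiv.swap_apply_right, Equiv.swap_apply_of_ne_of_ne hab hac] at h₃
  have hf' : X j * r a b (r a c f) + X j * r b c (r a b f) + X j * r a c (r b c f) = 0 := by
    rw [← mul_add, ← mul_add, hf, mul_zero]
  rw [hrX _ _ hac, hrX _ _ hab, hrX _ _ hbc, map_sub, map_sub, map_sub, hrX _ _ hab, hrX _ _ hac,
    hrX _ _ hbc]
  refine Eq.trans ?_ hf'
  split_ifs <;> simp only [h₁, h₂, h₃, map_zero] <;> abel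

theorem oddOp_braid
    (hs : ∀ i k j : Fin n, i ≠ k → s i k (X j) = X (Equiv.swap i k j))
    (hr1 : ∀ i k : Fin n, i ≠ k → r i k 1 = 0)
    (hrX : ∀ i k : Fin n, i ≠ k → ∀ (j : Fin n) (f : SkewPoly n),
      r i k (X j * f) = (if j = i ∨ j = k then s i k f else 0) - X j * r i k f)
    {a b c : Fin n} (hab : a ≠ b) (hbc : b ≠ c) (hac : a ≠ c) :
    r a b * r b c * r a b = r b c * r a b * r b c := by
  refine SkewPoly.linearMap_ext (by simp [hr1 _ _ hab, hr1 _ _ hbc]) fun j f hf => ?_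
  simp only [Module.End.mul_apply] at hf ⊢
  have hconj : ∀ g, r a b (s a b g) = s a b (r a b g) ∧ r b c (s b c g) = s b c (r b c g) ∧
      r b c (s a b g) = s a b (r a c g) ∧ r a b (s b c g) = s b c (r a c g) := by
    intro g
    refine ⟨?_, ?_, ?_, ?_⟩
    · rw [oddOp_swapHom_apply hs hr1 hrX hab hab, Equiv.swap_apply_left, Equiv.swap_apply_right,
        oddOp_comm hs hr1 hrX hab.symm]
    · rw [oddOp_swapHom_apply hs hr1 hrX hbc hbc, Equiv.swap_apply_left, Equiv.swap_apply_right,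
        oddOp_comm hs hr1 hrX hbc.symm]
    · rw [oddOp_swapHom_apply hs hr1 hrX hbc hab, Equiv.swap_apply_right,
        Equiv.swap_apply_of_ne_of_ne hac.symm hbc.symm]
    · rw [oddOp_swapHom_apply hs hr1 hrX hab hbc, Equiv.swap_apply_left,
        Equiv.swap_apply_of_ne_of_ne hab hac]
  have t₁ := congrArg (s a b) (LinearMap.congr_fun (oddOp_three_term hs hr1 hrX hab hbc hac) f)
  have t₂ := congrArg (s b c) (LinearMap.congr_fun
    (oddOp_three_term hs hr1 hrX hbc.symm hab.symm hac.symm) f)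
  rw [oddOp_comm hs hr1 hrX hbc.symm, oddOp_comm hs hr1 hrX hab.symm,
    oddOp_comm hs hr1 hrX hac.symm] at t₂
  simp only [Module.End.mul_apply, LinearMap.add_apply, LinearMap.zero_apply, map_add,
    map_zero] at t₁ t₂
  have e₁ : r a b (r b c (r a b (X j * f))) =
      (if j = a ∨ j = b then s a b (r a b (r a c f)) + s a b (r b c (r a b f)) else 0) -
      (if j = b ∨ j = c then s b c (r a c (r a b f)) else 0) - X j * r a b (r b c (r a b f)) := by
    rw [hrX _ _ hab, map_sub, hrX _ _ hbc, map_sub, map_sub, hrX _ _ hab]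
    split_ifs <;> simp only [hconj, map_zero] <;> abel
  have e₂ : r b c (r a b (r b c (X j * f))) =
      (if j = b ∨ j = c then s b c (r b c (r a c f)) + s b c (r a b (r b c f)) else 0) -
      (if j = a ∨ j = b then s a b (r a c (r b c f)) else 0) - X j * r b c (r a b (r b c f)) := by
    rw [hrX _ _ hbc, map_sub, hrX _ _ hab, map_sub, map_sub, hrX _ _ hbc]
    split_ifs <;> simp only [hconj, map_zero] <;> abel
  rw [e₁, e₂, hf, ← sub_eq_zero]
  split_ifs
  · linear_combination (norm := module) t₁ - t₂
  · linear_combination (norm := module) t₁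
  · linear_combination (norm := module) -t₂
  · simp

end SkewPolyOperators

/-- The operators `rᵢ = r_{i,i+1}` satisfy `rᵢ² = 0`, anticommutativity at distance ≥ 2, and
the braid relation. -/
theorem stmt1 (n : ℕ) (hn : 2 ≤ n)
    -- `s i k` is the algebra automorphism of `P⁻` swapping `xᵢ` and `x_k`
    (s : Fin n → Fin n → (SkewPoly n →ₐ[ℂ] SkewPoly n))
    (hs : ∀ i k j : Fin n, i ≠ k → s i k (X j) = X (Equiv.swap i k j))
    -- `pd i k` is the odd divided difference operator `∂_{i,k}`
    (pd : Fin n → Fin n → Module.End ℂ (SkewPoly n))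
    (hpdi : ∀ i k : Fin n, i ≠ k → pd i k (X i) = 1)
    (hpdk : ∀ i k : Fin n, i ≠ k → pd i k (X k) = 1)
    (hpd0 : ∀ i k j : Fin n, i ≠ k → j ≠ i → j ≠ k → pd i k (X j) = 0)
    (hpdL : ∀ i k : Fin n, i ≠ k → ∀ (d : ℕ) (f g : SkewPoly n), IsHomog d f →
      pd i k (f * g) = pd i k f * g + (-1 : ℂ) ^ d • (s i k f * pd i k g))
    -- `r i k = ∂_{i,k} ∘ s_{i,k}`
    (r : Fin n → Fin n → Module.End ℂ (SkewPoly n))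
    (hr : ∀ i k : Fin n, i ≠ k → r i k = pd i k ∘ₗ (s i k).toLinearMap)
 :
    (∀ i i' : Fin n, (i' : ℕ) = (i : ℕ) + 1 → r i i' * r i i' = 0) ∧
    (∀ i i' j j' : Fin n, (i' : ℕ) = (i : ℕ) + 1 → (j' : ℕ) = (j : ℕ) + 1 →
      ((i : ℕ) + 2 ≤ (j : ℕ) ∨ (j : ℕ) + 2 ≤ (i : ℕ)) →
      r i i' * r j j' + r j j' * r i i' = 0) ∧
    (∀ i i' i'' : Fin n, (i' : ℕ) = (i : ℕ) + 1 → (i'' : ℕ) = (i : ℕ) + 2 →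
      r i i' * r i' i'' * r i i' = r i' i'' * r i i' * r i' i'') := by
  have hpd1 : ∀ i k : Fin n, i ≠ k → pd i k 1 = 0 := by
    intro i k h
    simpa using hpdL i k h 0 1 1 isHomog_one
  have hr1 : ∀ i k : Fin n, i ≠ k → r i k 1 = 0 := by
    intro i k h
    simp [hr i k h, hpd1 i k h]
  have hpdX : ∀ i k : Fin n, i ≠ k → ∀ j : Fin n,
      pd i k (X (Equiv.swap i k j)) = if j = i ∨ j = k then 1 else 0 := by
    intro i k h j
    split_ifs with hj
    · rcases hj with rfl | rfl
      · rw [Equiv.swap_apply_left, hpdk _ _ h]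
      · rw [Equiv.swap_apply_right, hpdi _ _ h]
    · rw [not_or] at hj
      rw [Equiv.swap_apply_of_ne_of_ne hj.1 hj.2, hpd0 _ _ _ h hj.1 hj.2]
  have hrX : ∀ i k : Fin n, i ≠ k → ∀ (j : Fin n) (f : SkewPoly n),
      r i k (X j * f) = (if j = i ∨ j = k then s i k f else 0) - X j * r i k f := by
    intro i k h j f
    simp only [hr i k h, LinearMap.comp_apply, AlgHom.toLinearMap_apply, map_mul, hs i k _ h]
    rw [hpdL i k h 1 _ _ (isHomog_X _), hpdX i k h, hs i k _ h, Equiv.swap_apply_self,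
      sub_eq_add_neg, pow_one]
    congr 1
    split_ifs <;> simp
  refine ⟨fun i i' h => oddOp_sq hs hr1 hrX ?_, fun i i' j j' h h' hij =>
    oddOp_anticomm hs hr1 hrX ?_ ?_ ?_ ?_ ?_ ?_, fun i i' i'' h h' =>
    oddOp_braid hs hr1 hrX ?_ ?_ ?_⟩ <;>
  · rw [Ne, Fin.ext_iff]
    omega
end
end

section
/- The operators E, r², and Δ on P⁻ satisfy the commutation relations [E, r²] = 2r² and [E, Δ] = −2Δ, where [A,B] = AB − BA. -/
noncomputable section

namespace SkewPoly

variable {n : ℕ}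

theorem mul_neg_eq (f g : SkewPoly n) : f * -g = -(f * g) :=
  mul_neg f g

theorem neg_one_smul_eq (f : SkewPoly n) : (-1 : ℂ) • f = -f :=
  neg_one_smul ℂ f

theorem X_anticomm {i j : Fin n} (h : i ≠ j) : X i * X j = -(X j * X i) := by
  have := RingQuot.mkAlgHom_rel ℂ (SkewRel.anticomm i j h)
  simpa [X] using this

theorem X_mul_X_mul {i j : Fin n} (h : i ≠ j) (f : SkewPoly n) :
    X i * (X j * f) = -(X j * (X i * f)) := by
  rw [← mul_assoc, X_anticomm h, ← mul_assoc]
  exact neg_mul (X j * X i) f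

@[elab_as_elim]
theorem induction_X_mul {P : SkewPoly n → Prop} (one : P 1)
    (X_mul : ∀ j f, P f → P (X j * f)) (add : ∀ f g, P f → P g → P (f + g))
    (smul : ∀ (c : ℂ) f, P f → P (c • f)) (f : SkewPoly n) : P f := by
  obtain ⟨a, rfl⟩ := RingQuot.mkAlgHom_surjective ℂ (SkewRel n) f
  suffices h : ∀ g, P g → P (RingQuot.mkAlgHom ℂ (SkewRel n) a * g) by
    simpa using h 1 one
  induction a using FreeAlgebra.induction with
  | grade0 c =>
    intro g hg
    rw [AlgHom.commutes, ← Algebra.smul_def]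
    exact smul c g hg
  | grade1 j => exact fun g hg => X_mul j g hg
  | mul a b ha hb =>
    intro g hg
    rw [map_mul, mul_assoc]
    exact ha _ (hb _ hg)
  | add a b ha hb =>
    intro g hg
    rw [map_add, add_mul]
    exact add _ _ (ha _ hg) (hb _ hg)

theorem end_ext {A B : Module.End ℂ (SkewPoly n)} (one : A 1 = B 1)
    (X_mul : ∀ j f, A f = B f → A (X j * f) = B (X j * f)) : A = B := by
  ext f
  induction f using induction_X_mul with
  | one => exact one
  | X_mul j f h => exact X_mul j f h
  | add f g hf hg => rw [map_add, map_add, hf, hg]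
  | smul c f hf => rw [map_smul, map_smul, hf]

theorem end_add_right_cancel {A B : Module.End ℂ (SkewPoly n)} (C : Module.End ℂ (SkewPoly n))
    (h : A + C = B + C) : A = B :=
  LinearMap.ext fun f => add_right_cancel (LinearMap.congr_fun h f)

/-- The ordered monomial `x₁^λ₁ ⋯ xₙ^λₙ`. -/
def mono (lam : Fin n → ℕ) : SkewPoly n :=
  ((List.finRange n).map fun j => X j ^ lam j).prod

theorem mono_zero : mono (0 : Fin n → ℕ) = 1 := by
  simp [mono]

theorem X_mul_X_pow {i j : Fin n} (h : i ≠ j) (m : ℕ) :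
    X i * X j ^ m = (-1 : ℂ) ^ m • (X j ^ m * X i) := by
  induction m with
  | zero => simp
  | succ m ih =>
    rw [pow_succ, ← mul_assoc, ih, smul_mul_assoc, mul_assoc, X_anticomm h, mul_neg_eq, ← neg_one_smul_eq,
      smul_smul, pow_succ, mul_assoc]

theorem X_mul_prod_of_sorted (lam : Fin n → ℕ) (j : Fin n) (l : List (Fin n))
    (hl : l.Pairwise (· < ·)) (hj : j ∈ l) :
    X j * (l.map fun k => X k ^ lam k).prod =
      (-1 : ℂ) ^ ((l.filter (· < j)).map lam).sum •
        (l.map fun k => X k ^ Function.update lam j (lam j + 1) k).prod := by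
  induction l with
  | nil => simp at hj
  | cons a l ih =>
    rw [List.pairwise_cons] at hl
    by_cases haj : a = j
    · subst haj
      have hf : l.filter (· < a) = [] := by
        rw [List.filter_eq_nil_iff]
        intro b hb
        simpa using (hl.1 b hb).le
      have hm : (l.map fun k => X k ^ Function.update lam a (lam a + 1) k) =
          l.map fun k => X k ^ lam k := by
        refine List.map_congr_left fun b hb => ?_
        rw [Function.update_of_ne (hl.1 b hb).ne']
      simp [hf, hm, pow_succ', mul_assoc]
    · have hjl : j ∈ l := by
        rcases List.mem_cons.1 hj with h | h
        · exact absurd h.symm haj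
        · exact h
      have hlt : a < j := hl.1 j hjl
      rw [List.map_cons, List.prod_cons, ← mul_assoc, X_mul_X_pow (Ne.symm haj),
        smul_mul_assoc, mul_assoc, ih hl.2 hjl]
      simp [hlt, haj, pow_add, smul_smul]

theorem X_mul_mono (lam : Fin n → ℕ) (j : Fin n) :
    X j * mono lam = (-1 : ℂ) ^ (∑ k ∈ Finset.Iio j, lam k) •
      mono (Function.update lam j (lam j + 1)) := by
  have h : (((List.finRange n).filter (· < j)).map lam).sum = ∑ k ∈ Finset.Iio j, lam k := by
    rw [← List.sum_toFinset _ ((List.nodup_finRange n).filter _)]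
    congr 1
    ext k
    simp
  rw [mono, X_mul_prod_of_sorted lam j _ (List.pairwise_lt_finRange n) (List.mem_finRange j), h,
    mono]

@[elab_as_elim]
theorem induction_mono {P : SkewPoly n → Prop} (mono : ∀ lam, P (mono lam))
    (add : ∀ f g, P f → P g → P (f + g)) (smul : ∀ (c : ℂ) f, P f → P (c • f))
    (f : SkewPoly n) : P f := by
  have hspan : f ∈ Submodule.span ℂ (Set.range (SkewPoly.mono (n := n))) := by
    induction f using induction_X_mul with
    | one => exact Submodule.subset_span ⟨0, mono_zero⟩
    | add f g hf hg => exact add_mem hf hg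
    | smul c f hf => exact Submodule.smul_mem _ c hf
    | X_mul j f hf =>
      induction hf using Submodule.span_induction with
      | mem x hx =>
        obtain ⟨lam, rfl⟩ := hx
        rw [X_mul_mono]
        exact Submodule.smul_mem _ _ (Submodule.subset_span ⟨_, rfl⟩)
      | zero => simp
      | add x y _ _ hx hy => rw [mul_add]; exact add_mem hx hy
      | smul c x _ hx => rw [mul_smul_comm]; exact Submodule.smul_mem _ c hx
  induction hspan using Submodule.span_induction with
  | mem x hx => obtain ⟨lam, rfl⟩ := hx; exact mono lam
  | zero => simpa using smul 0 _ (mono 0)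
  | add x y _ _ hx hy => exact add _ _ hx hy
  | smul c x _ hx => exact smul c x hx

theorem sum_Iio_update_succ (lam : Fin n → ℕ) (i j : Fin n) :
    ∑ k ∈ Finset.Iio i, Function.update lam j (lam j + 1) k =
      (∑ k ∈ Finset.Iio i, lam k) + if j < i then 1 else 0 := by
  have h : ∀ k, Function.update lam j (lam j + 1) k = lam k + if k = j then 1 else 0 := by
    intro k
    by_cases hk : k = j
    · subst hk; simp
    · simp [hk]
  simp [h, Finset.sum_add_distrib]

theorem exists_update_succ {lam : Fin n → ℕ} {i : Fin n} (h : lam i ≠ 0) :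
    ∃ mu : Fin n → ℕ, lam = Function.update mu i (mu i + 1) :=
  ⟨Function.update lam i (lam i - 1), by simp [Nat.sub_add_cancel (Nat.pos_of_ne_zero h)]⟩

/-- The value of the odd partial derivative on the monomial basis. -/
def IsPartial (i : Fin n) (q : Module.End ℂ (SkewPoly n)) : Prop :=
  ∀ lam, q (mono lam) = ((lam i : ℂ) * (-1 : ℂ) ^ (∑ j ∈ Finset.Iio i, lam j)) •
    mono (Function.update lam i (lam i - 1))

namespace IsPartial

variable {i : Fin n} {q : Module.End ℂ (SkewPoly n)}

theorem map_one (hq : IsPartial i q) : q 1 = 0 := by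
  rw [← mono_zero, hq]
  simp

theorem map_mono_update (hq : IsPartial i q) (lam : Fin n → ℕ) :
    q (mono (Function.update lam i (lam i + 1))) =
      (((lam i : ℂ) + 1) * (-1 : ℂ) ^ (∑ j ∈ Finset.Iio i, lam j)) • mono lam := by
  rw [hq, sum_Iio_update_succ]
  simp

theorem X_self_mul (hq : IsPartial i q) (f : SkewPoly n) :
    q (X i * f) = f + X i * q f := by
  induction f using induction_mono with
  | add f g hf hg => rw [mul_add, map_add, hf, hg, map_add, mul_add]; abel
  | smul c f hf => rw [mul_smul_comm, map_smul, hf, map_smul, mul_smul_comm, smul_add]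
  | mono lam =>
    have hsq (m : ℕ) : (-1 : ℂ) ^ m * (-1) ^ m = 1 := by rw [← mul_pow]; simp
    have hX : X i * q (mono lam) = (lam i : ℂ) • mono lam := by
      by_cases h0 : lam i = 0
      · rw [hq, h0]; simp
      · obtain ⟨mu, rfl⟩ := exists_update_succ h0
        rw [hq.map_mono_update, mul_smul_comm, X_mul_mono, smul_smul, mul_assoc, hsq]
        simp
    rw [hX, X_mul_mono, map_smul, hq.map_mono_update, smul_smul, mul_left_comm, hsq, mul_one,
      add_smul, one_smul, add_comm]

theorem X_mul_of_ne (hq : IsPartial i q) {j : Fin n} (hij : j ≠ i) (f : SkewPoly n) :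
    q (X j * f) = -(X j * q f) := by
  induction f using induction_mono with
  | add f g hf hg => rw [mul_add, map_add, hf, hg, map_add, mul_add]; abel
  | smul c f hf => rw [mul_smul_comm, map_smul, hf, map_smul, mul_smul_comm, smul_neg]
  | mono lam =>
    by_cases h0 : lam i = 0
    · rw [X_mul_mono, map_smul, hq, hq, Function.update_of_ne hij.symm, h0]; simp
    · obtain ⟨mu, rfl⟩ := exists_update_succ h0
      have hc : Function.update (Function.update mu i (mu i + 1)) j
            (Function.update mu i (mu i + 1) j + 1) =
          Function.update (Function.update mu j (mu j + 1)) i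
            (Function.update mu j (mu j + 1) i + 1) := by
        rw [Function.update_comm hij, Function.update_of_ne hij, Function.update_of_ne hij.symm]
      rw [X_mul_mono, hc, map_smul, hq.map_mono_update, hq.map_mono_update, mul_smul_comm,
        X_mul_mono, smul_smul, smul_smul, ← neg_smul, sum_Iio_update_succ, sum_Iio_update_succ,
        Function.update_of_ne hij.symm]
      congr 1
      rcases lt_or_gt_of_ne hij with h | h
      · simp [h, h.not_gt, pow_succ]; ring
      · simp [h, h.not_gt, pow_succ]; ring

end IsPartial

section Operators

theorem mulX_apply (i : Fin n) (f : SkewPoly n) : mulX i f = X i * f := rfl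

theorem sum_X_mul_partial {p : Fin n → Module.End ℂ (SkewPoly n)} (hp : ∀ i, IsPartial i (p i))
    (j : Fin n) (f : SkewPoly n) :
    (∑ i, mulX i * p i) (X j * f) = X j * f + X j * (∑ i, mulX i * p i) f := by
  have h (i : Fin n) : X i * p i (X j * f) =
      (if i = j then X j * f else 0) + X j * (X i * p i f) := by
    by_cases hij : i = j
    · subst hij
      rw [(hp i).X_self_mul, mul_add, if_pos rfl]
    · rw [(hp i).X_mul_of_ne (Ne.symm hij), mul_neg_eq, X_mul_X_mul hij]
      simp [hij]
  simp [mulX_apply, h, Finset.sum_add_distrib, Finset.mul_sum]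

/-- `N` is the Euler operator, multiplying a form by its degree. -/
structure IsEuler (N : Module.End ℂ (SkewPoly n)) : Prop where
  map_one : N 1 = 0
  X_mul : ∀ j f, N (X j * f) = X j * f + X j * N f

theorem isEuler_sum {p : Fin n → Module.End ℂ (SkewPoly n)} (hp : ∀ i, IsPartial i (p i)) :
    IsEuler (∑ i, mulX i * p i) where
  map_one := by simp [(hp _).map_one]
  X_mul := sum_X_mul_partial hp

theorem IsEuler.mul_partial {N q : Module.End ℂ (SkewPoly n)} (hN : IsEuler N) {i : Fin n}
    (hq : IsPartial i q) : N * q + q = q * N := by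
  refine end_ext (by simp [hN.map_one, hq.map_one]) fun j f h => ?_
  simp only [Module.End.mul_apply, LinearMap.add_apply] at h ⊢
  by_cases hj : j = i
  · subst hj
    simp only [hq.X_self_mul, hN.X_mul, map_add, ← h, mul_add]
    abel
  · simp only [hq.X_mul_of_ne hj, hN.X_mul, map_add, map_neg, ← h, mul_add]
    abel

theorem IsEuler.mul_perm {N : Module.End ℂ (SkewPoly n)} (hN : IsEuler N) {σ : Fin n → Fin n}
    {φ : SkewPoly n →ₐ[ℂ] SkewPoly n} (hφ : ∀ j, φ (X j) = X (σ j)) :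
    N * φ.toLinearMap = φ.toLinearMap * N := by
  refine end_ext (by simp [hN.map_one]) fun j f h => ?_
  simp only [Module.End.mul_apply, AlgHom.toLinearMap_apply] at h ⊢
  simp only [map_mul, hφ, hN.X_mul, map_add, h]

/-- `d` is the odd divided difference operator `∂_{i,k}`, described by its action on products
with a generator on the left. -/
structure IsDividedDifference (i k : Fin n) (d : Module.End ℂ (SkewPoly n)) : Prop where
  map_one : d 1 = 0
  X_mul : ∀ j f, d (X j * f) = (if j = i ∨ j = k then f else 0) - X (Equiv.swap i k j) * d f

theorem IsEuler.mul_dividedDifference {N d : Module.End ℂ (SkewPoly n)} (hN : IsEuler N)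
    {i k : Fin n} (hd : IsDividedDifference i k d) : N * d + d = d * N := by
  refine end_ext (by simp [hN.map_one, hd.map_one]) fun j f h => ?_
  simp only [Module.End.mul_apply, LinearMap.add_apply] at h ⊢
  by_cases hj : j = i ∨ j = k
  · simp only [hd.X_mul, hN.X_mul, map_add, map_sub, ← h, mul_add, if_pos hj]
    abel
  · simp only [hd.X_mul, hN.X_mul, map_add, map_sub, ← h, mul_add, if_neg hj, map_zero]
    abel

variable {σ : Equiv.Perm (Fin n)} {φ : SkewPoly n →ₐ[ℂ] SkewPoly n}

theorem perm_mul_partial (hφ : ∀ j, φ (X j) = X (σ j)) {i : Fin n}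
    {q q' : Module.End ℂ (SkewPoly n)} (hq : IsPartial i q) (hq' : IsPartial (σ i) q') :
    φ.toLinearMap * q = q' * φ.toLinearMap := by
  refine end_ext (by simp [hq.map_one, hq'.map_one]) fun j f h => ?_
  simp only [Module.End.mul_apply, AlgHom.toLinearMap_apply] at h ⊢
  by_cases hj : j = i
  · subst hj
    simp only [hq.X_self_mul, map_mul, hφ, hq'.X_self_mul, map_add, h]
  · have hj' : σ j ≠ σ i := fun e => hj (σ.injective e)
    simp only [hq.X_mul_of_ne hj, map_mul, hφ, hq'.X_mul_of_ne hj', map_neg, h]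

theorem perm_swap_apply (i k j : Fin n) :
    σ (Equiv.swap i k j) = Equiv.swap (σ i) (σ k) (σ j) :=
  (Equiv.swap_apply_apply σ i k ▸ by simp)

theorem perm_mul_dividedDifference (hφ : ∀ j, φ (X j) = X (σ j)) {i k : Fin n}
    {d d' : Module.End ℂ (SkewPoly n)} (hd : IsDividedDifference i k d)
    (hd' : IsDividedDifference (σ i) (σ k) d') :
    φ.toLinearMap * d = d' * φ.toLinearMap := by
  refine end_ext (by simp [hd.map_one, hd'.map_one]) fun j f h => ?_
  simp only [Module.End.mul_apply, AlgHom.toLinearMap_apply] at h ⊢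
  simp only [hd.X_mul, map_sub, map_mul, hφ, hd'.X_mul, h, perm_swap_apply, σ.injective.eq_iff]
  split_ifs <;> simp

theorem perm_mul_swap (hφ : ∀ j, φ (X j) = X (σ j)) {i k : Fin n}
    {ψ ψ' : SkewPoly n →ₐ[ℂ] SkewPoly n} (hψ : ∀ j, ψ (X j) = X (Equiv.swap i k j))
    (hψ' : ∀ j, ψ' (X j) = X (Equiv.swap (σ i) (σ k) j)) :
    φ.toLinearMap * ψ.toLinearMap = ψ'.toLinearMap * φ.toLinearMap := by
  refine end_ext (by simp) fun j f h => ?_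
  simp only [Module.End.mul_apply, AlgHom.toLinearMap_apply] at h ⊢
  simp only [map_mul, hφ, hψ, hψ', h, perm_swap_apply]

theorem perm_mul_sum_sq (hφ : ∀ j, φ (X j) = X (σ j)) :
    φ.toLinearMap * ∑ i, mulX i ^ 2 = (∑ i, mulX i ^ 2) * φ.toLinearMap := by
  ext f
  simp only [Module.End.mul_apply, LinearMap.sum_apply, map_sum, pow_two, mulX_apply,
    AlgHom.toLinearMap_apply, map_mul, hφ]
  exact Equiv.sum_comp σ fun i => X i * (X i * φ f)

theorem isHomog_X (j : Fin n) : IsHomog 1 (X j) :=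
  Submodule.subset_span ⟨[j], rfl, by simp⟩

theorem isHomog_one : IsHomog 0 (1 : SkewPoly n) :=
  Submodule.subset_span ⟨[], rfl, by simp⟩

end Operators

end SkewPoly

/-- The commutation relations `[E, r²] = 2r²` and `[E, Δ] = −2Δ`. -/
theorem stmt13 (n : ℕ) (hn : 2 ≤ n)
    -- `s i k` is the algebra automorphism of `P⁻` swapping `xᵢ` and `x_k`
    (s : Fin n → Fin n → (SkewPoly n →ₐ[ℂ] SkewPoly n))
    (hs : ∀ i k j : Fin n, i ≠ k → s i k (X j) = X (Equiv.swap i k j))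
    -- `τ i` is the algebra automorphism of `P⁻` sending `xᵢ` to `-xᵢ` and fixing the others
    (τ : Fin n → (SkewPoly n →ₐ[ℂ] SkewPoly n))
    (hτ : ∀ i j : Fin n, τ i (X j) = if j = i then -X j else X j)
    -- `pd i k` is the odd divided difference operator `∂_{i,k}`
    (pd : Fin n → Fin n → Module.End ℂ (SkewPoly n))
    (hpdi : ∀ i k : Fin n, i ≠ k → pd i k (X i) = 1)
    (hpdk : ∀ i k : Fin n, i ≠ k → pd i k (X k) = 1)
    (hpd0 : ∀ i k j : Fin n, i ≠ k → j ≠ i → j ≠ k → pd i k (X j) = 0)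
    (hpdL : ∀ i k : Fin n, i ≠ k → ∀ (d : ℕ) (f g : SkewPoly n), IsHomog d f →
      pd i k (f * g) = pd i k f * g + (-1 : ℂ) ^ d • (s i k f * pd i k g))
    -- `r i k = ∂_{i,k} ∘ s_{i,k}`
    (r : Fin n → Fin n → Module.End ℂ (SkewPoly n))
    (hr : ∀ i k : Fin n, i ≠ k → r i k = pd i k ∘ₗ (s i k).toLinearMap)
    -- `p i` is the operator `pᵢ`, defined on the monomial basis
    (p : Fin n → Module.End ℂ (SkewPoly n))
    (hp : ∀ (i : Fin n) (lam : Fin n → ℕ),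
      p i (((List.finRange n).map fun j => X j ^ lam j).prod)
        = ((lam i : ℂ) * (-1 : ℂ) ^ (∑ j ∈ Finset.Iio i, lam j)) •
            ((List.finRange n).map fun j => X j ^ (Function.update lam i (lam i - 1)) j).prod)
    (t u : ℂ) (ht : t ≠ 0)
    -- `D i = t pᵢ + u Σ_{k ≠ i} r_{i,k}`
    (D : Fin n → Module.End ℂ (SkewPoly n))
    (hD : ∀ i : Fin n, D i = t • p i + u • ∑ k ∈ Finset.univ \ {i}, r i k)
    -- `Δ = −(2t)⁻¹ Σᵢ Dᵢ²`
    (Δ : Module.End ℂ (SkewPoly n))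
    (hΔ : Δ = (-(2 * t)⁻¹) • ∑ i : Fin n, D i ^ 2)
    -- `E = Σᵢ xᵢ pᵢ + n/2 + (u/t) Σᵢ Σ_{k ≠ i} s_{i,k}`
    (E : Module.End ℂ (SkewPoly n))
    (hE : E = (∑ i : Fin n, mulX i * p i) + ((n : ℂ) / 2) • (1 : Module.End ℂ (SkewPoly n))
      + (u / t) • ∑ i : Fin n, ∑ k ∈ Finset.univ \ {i}, (s i k).toLinearMap)
    -- `r² = (2t)⁻¹ Σᵢ xᵢ²`
    (R2 : Module.End ℂ (SkewPoly n))
    (hR2 : R2 = (2 * t)⁻¹ • ∑ i : Fin n, mulX i ^ 2)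
 :
    E * R2 - R2 * E = (2 : ℂ) • R2 ∧ E * Δ - Δ * E = (-2 : ℂ) • Δ := by
  have hp' (i : Fin n) : SkewPoly.IsPartial i (p i) := hp i
  have hN := SkewPoly.isEuler_sum hp'
  have hd {i k : Fin n} (h : i ≠ k) : SkewPoly.IsDividedDifference i k (pd i k) := by
    constructor
    · have := hpdL i k h 0 1 1 SkewPoly.isHomog_one
      simpa using this
    · intro j f
      rw [hpdL i k h 1 _ f (SkewPoly.isHomog_X j), hs i k j h, pow_one,
        SkewPoly.neg_one_smul_eq, ← sub_eq_add_neg]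
      by_cases h1 : j = i
      · simp [h1, hpdi i k h]
      by_cases h2 : j = k
      · simp [h2, hpdk i k h]
      simp [h1, h2, hpd0 i k j h h1 h2]
  set N := ∑ i : Fin n, mulX i * p i with hNdef
  have hne {i k : Fin n} (h : k ∈ Finset.univ \ {i}) : i ≠ k := by
    rintro rfl
    simp at h
  have hNr {i k : Fin n} (h : i ≠ k) : N * r i k + r i k = r i k * N := by
    have hr' : r i k = pd i k * (s i k).toLinearMap := hr i k h
    rw [hr', ← mul_assoc, ← add_mul, hN.mul_dividedDifference (hd h), mul_assoc,
      hN.mul_perm fun j => hs i k j h, mul_assoc]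
  have hND (i : Fin n) : N * D i + D i = D i * N := by
    have h : ∑ k ∈ Finset.univ \ {i}, (N * r i k + r i k) =
        ∑ k ∈ Finset.univ \ {i}, r i k * N :=
      Finset.sum_congr rfl fun k hk => hNr (hne hk)
    rw [Finset.sum_add_distrib, ← Finset.mul_sum, ← Finset.sum_mul] at h
    rw [hD, mul_add, add_mul, mul_smul_comm, mul_smul_comm, smul_mul_assoc, smul_mul_assoc,
      ← hN.mul_partial (hp' i), ← h, smul_add, smul_add, add_add_add_comm]
  have hNΔ : N * Δ + (2 : ℂ) • Δ = Δ * N := by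
    have h (i : Fin n) : N * D i ^ 2 + (2 : ℂ) • D i ^ 2 = D i ^ 2 * N := by
      rw [pow_two, mul_assoc, ← hND, mul_add, ← mul_assoc, ← mul_assoc, ← hND, add_mul,
        add_assoc, two_smul]
    rw [hΔ, mul_smul_comm, smul_mul_assoc, smul_comm, ← smul_add, Finset.mul_sum, Finset.sum_mul,
      Finset.smul_sum, ← Finset.sum_add_distrib, Finset.sum_congr rfl fun i _ => h i]
  have hNX (i : Fin n) : N * mulX i = mulX i * N + mulX i := by
    ext f
    simp [SkewPoly.mulX_apply, hN.X_mul, add_comm]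
  have hNR : N * R2 = R2 * N + (2 : ℂ) • R2 := by
    have h (i : Fin n) : N * mulX i ^ 2 = mulX i ^ 2 * N + (2 : ℂ) • mulX i ^ 2 := by
      rw [pow_two, ← mul_assoc, hNX, add_mul, mul_assoc, hNX, mul_add,
        two_smul, add_assoc, mul_assoc]
    rw [hR2, mul_smul_comm, Finset.mul_sum, Finset.sum_congr rfl fun i _ => h i,
      Finset.sum_add_distrib, ← Finset.sum_mul, ← Finset.smul_sum, smul_mul_assoc, smul_add,
      smul_comm]
  have hsr {a b i k : Fin n} (hab : a ≠ b) (h : i ≠ k) :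
      (s a b).toLinearMap * r i k =
        r (Equiv.swap a b i) (Equiv.swap a b k) * (s a b).toLinearMap := by
    have h' : Equiv.swap a b i ≠ Equiv.swap a b k := (Equiv.swap a b).injective.ne h
    have h1 : r i k = pd i k * (s i k).toLinearMap := hr i k h
    have h2 := hr _ _ h'
    rw [← Module.End.mul_eq_comp] at h2
    have hφ := fun j => hs a b j hab
    rw [h1, h2, ← mul_assoc, SkewPoly.perm_mul_dividedDifference hφ (hd h) (hd h'), mul_assoc,
      SkewPoly.perm_mul_swap hφ (fun j => hs i k j h) (fun j => hs _ _ j h'), mul_assoc]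
  have hsD {a b : Fin n} (hab : a ≠ b) (i : Fin n) :
      (s a b).toLinearMap * D i = D (Equiv.swap a b i) * (s a b).toLinearMap := by
    rw [hD, hD, mul_add, add_mul, mul_smul_comm, smul_mul_assoc,
      SkewPoly.perm_mul_partial (fun j => hs a b j hab) (hp' i) (hp' _), mul_smul_comm,
      smul_mul_assoc, Finset.mul_sum, Finset.sum_mul]
    congr 2
    refine Finset.sum_equiv (Equiv.swap a b) (fun k => ?_) fun k hk => hsr hab (hne hk)
    simp
  have hsΔ {a b : Fin n} (hab : a ≠ b) :
      (s a b).toLinearMap * Δ = Δ * (s a b).toLinearMap := by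
    have h (i : Fin n) : (s a b).toLinearMap * D i ^ 2 =
        D (Equiv.swap a b i) ^ 2 * (s a b).toLinearMap := by
      rw [pow_two, ← mul_assoc, hsD hab, mul_assoc, hsD hab, pow_two, mul_assoc]
    rw [hΔ, mul_smul_comm, smul_mul_assoc, Finset.mul_sum, Finset.sum_congr rfl fun i _ => h i,
      ← Finset.sum_mul, Equiv.sum_comp (Equiv.swap a b) fun i => D i ^ 2]
  have hsR {a b : Fin n} (hab : a ≠ b) :
      (s a b).toLinearMap * R2 = R2 * (s a b).toLinearMap := by
    rw [hR2, mul_smul_comm, smul_mul_assoc, SkewPoly.perm_mul_sum_sq fun j => hs a b j hab]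
  have hS (A : Module.End ℂ (SkewPoly n))
      (hA : ∀ a b : Fin n, a ≠ b → (s a b).toLinearMap * A = A * (s a b).toLinearMap) :
      E * A + A * N = N * A + A * E := by
    have h : (∑ i : Fin n, ∑ k ∈ Finset.univ \ {i}, (s i k).toLinearMap) * A =
        A * ∑ i : Fin n, ∑ k ∈ Finset.univ \ {i}, (s i k).toLinearMap := by
      simp only [Finset.sum_mul, Finset.mul_sum]
      exact Finset.sum_congr rfl fun i _ => Finset.sum_congr rfl fun k hk => hA i k (hne hk)
    rw [hE, add_mul, add_mul, mul_add, mul_add, smul_mul_assoc, smul_mul_assoc, mul_smul_comm,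
      mul_smul_comm, h, one_mul, mul_one]
    abel
  refine ⟨sub_eq_of_eq_add (SkewPoly.end_add_right_cancel (R2 * N) ?_),
    sub_eq_of_eq_add (SkewPoly.end_add_right_cancel (Δ * N) ?_)⟩
  · rw [hS R2 fun a b h => hsR h, hNR]
    abel
  · rw [hS Δ fun a b h => hsΔ h, add_right_comm, ← hNΔ, add_left_comm, ← add_smul]
    simp
end
end
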